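/- Fix a natural number M and set N = 2M. Define the twist-2 Baxter polynomial Q : ℂ → ℂ by Q(u) = Σ_{k=0}^{M} (−M)_k · (1/2 + i·u)_k · (1/2 − i·u)_k / (k!)³, i.e. the terminating hypergeometric series ₃F₂(−M, 1/2+i·u, 1/2−i·u; 1, 1; 1). Then for every u ∈ ℂ, (u + i/2)²·Q(u + i) − (u − i/2)²·Q(u − i) = i·(2N+2)·u·Q(u). -/

import Mathlib

/-- Twist-2 Baxter polynomial `Q(u) = ₃F₂(−M, 1/2+i·u, 1/2−i·u; 1, 1; 1)
 = Σ_{k=0}^{M} (−M)_k (1/2+i·u)_k (1/2−i·u)_k / (k!)³`. -/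
noncomputable def baxterQ2 (M : ℕ) (u : ℂ) : ℂ :=
  ∑ k ∈ Finset.range (M + 1),
    (ascPochhammer ℂ k).eval (-(M : ℂ)) *
      (ascPochhammer ℂ k).eval (1 / 2 + Complex.I * u) *
      (ascPochhammer ℂ k).eval (1 / 2 - Complex.I * u) / ((k.factorial : ℂ)) ^ 3

/-- `a (a + 1)_n = (a)_n (a + n)`. -/
theorem mul_ascPochhammer_eval_add_one (a : ℂ) (n : ℕ) :
    a * (ascPochhammer ℂ n).eval (a + 1) = (ascPochhammer ℂ n).eval a * (a + n) := by
  rw [← ascPochhammer_succ_eval, ascPochhammer_succ_left]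
  simp

/-- The `(n+1)`-st factor `(a - 1)_{n+1} = (a - 1) (a)_n`. -/
theorem ascPochhammer_succ_eval_sub_one (a : ℂ) (n : ℕ) :
    (ascPochhammer ℂ (n + 1)).eval (a - 1) = (a - 1) * (ascPochhammer ℂ n).eval a := by
  rw [ascPochhammer_succ_left]
  simp

/-- Shifting `x` down and `y` up by one in `(x)_{n+1} (y)_{n+1}`, multiplied by `y ^ 2`. -/
theorem sq_mul_ascPochhammer_shift (x y : ℂ) (n : ℕ) :
    y ^ 2 * ((ascPochhammer ℂ (n + 1)).eval (x - 1) * (ascPochhammer ℂ (n + 1)).eval (y + 1)) =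
      y * (x - 1) * (y + n) * (y + n + 1) *
        ((ascPochhammer ℂ n).eval x * (ascPochhammer ℂ n).eval y) := by
  have h := mul_ascPochhammer_eval_add_one y (n + 1)
  rw [ascPochhammer_succ_eval n y] at h
  rw [ascPochhammer_succ_eval_sub_one]
  push_cast at h
  linear_combination y * (x - 1) * (ascPochhammer ℂ n).eval x * h

/-- The `k`-th summand of `₃F₂(-m, x, y; 1, 1; 1)`. -/
noncomputable def baxterTerm (m x y : ℂ) (k : ℕ) : ℂ :=
  (ascPochhammer ℂ k).eval (-m) * (ascPochhammer ℂ k).eval x * (ascPochhammer ℂ k).eval y /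
    (k.factorial : ℂ) ^ 3

/-- The partial sums of the Baxter difference operator telescope when `x + y = 1`. -/
theorem sum_baxterTerm_shift (m x y : ℂ) (hxy : x + y = 1) (n : ℕ) :
    ∑ k ∈ Finset.range (n + 1),
        (x ^ 2 * baxterTerm m (x + 1) (y - 1) k - y ^ 2 * baxterTerm m (x - 1) (y + 1) k
          - (2 * m + 1) * (x - y) * baxterTerm m x y k) =
      2 * (n - m) * (x - y) * baxterTerm m x y n := by
  obtain rfl : y = 1 - x := by linear_combination hxy
  induction n with
  | zero => simp [baxterTerm]; ring
  | succ n ih =>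
    rw [Finset.sum_range_succ, ih]
    have h1 := sq_mul_ascPochhammer_shift x (1 - x) n
    have h2 := sq_mul_ascPochhammer_shift (1 - x) x n
    have hn : (n : ℂ) + 1 ≠ 0 := Nat.cast_add_one_ne_zero n
    have hf : (n.factorial : ℂ) ≠ 0 := Nat.cast_ne_zero.mpr n.factorial_ne_zero
    simp only [baxterTerm, Nat.factorial_succ]
    have hx := ascPochhammer_succ_eval n x
    have hy := ascPochhammer_succ_eval n (1 - x)
    have hm := ascPochhammer_succ_eval n (-m)
    rw [hm, hx, hy]
    push_cast
    field_simp
    linear_combination (ascPochhammer ℂ n).eval (-m) * (n - m) * (h2 - h1)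

/-- The twist-2 leading-order Baxter equation with `N = 2M`:
`(u + i/2)²·Q(u + i) − (u − i/2)²·Q(u − i) = i·(2N+2)·u·Q(u)`. -/
theorem twist2_baxter_equation (M : ℕ) (u : ℂ) :
    (u + Complex.I / 2) ^ 2 * baxterQ2 M (u + Complex.I)
      - (u - Complex.I / 2) ^ 2 * baxterQ2 M (u - Complex.I)
      = Complex.I * (2 * ((2 * M : ℕ) : ℂ) + 2) * u * baxterQ2 M u := by
  have hI : Complex.I ^ 2 = -1 := Complex.I_sq
  have h := sum_baxterTerm_shift M (1 / 2 + Complex.I * u) (1 / 2 - Complex.I * u) (by ring) M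
  rw [sub_self, mul_zero, zero_mul, zero_mul, Finset.sum_sub_distrib, Finset.sum_sub_distrib,
    ← Finset.mul_sum, ← Finset.mul_sum, ← Finset.mul_sum] at h
  have hQ (v : ℂ) : baxterQ2 M v = ∑ k ∈ Finset.range (M + 1),
      baxterTerm M (1 / 2 + Complex.I * v) (1 / 2 - Complex.I * v) k := rfl
  have e1 : 1 / 2 + Complex.I * (u + Complex.I) = 1 / 2 + Complex.I * u - 1 := by
    linear_combination hI
  have e2 : 1 / 2 - Complex.I * (u + Complex.I) = 1 / 2 - Complex.I * u + 1 := by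
    linear_combination -hI
  have e3 : 1 / 2 + Complex.I * (u - Complex.I) = 1 / 2 + Complex.I * u + 1 := by
    linear_combination -hI
  have e4 : 1 / 2 - Complex.I * (u - Complex.I) = 1 / 2 - Complex.I * u - 1 := by
    linear_combination hI
  have s1 : (u + Complex.I / 2) ^ 2 = -(1 / 2 - Complex.I * u) ^ 2 := by
    linear_combination (u ^ 2 + 1 / 4) * hI
  have s2 : (u - Complex.I / 2) ^ 2 = -(1 / 2 + Complex.I * u) ^ 2 := by
    linear_combination (u ^ 2 + 1 / 4) * hI
  rw [hQ (u + Complex.I), hQ (u - Complex.I), hQ u, e1, e2, e3, e4, s1, s2]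
  push_cast
  linear_combination h
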